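/- Let S be a set, R a binary relation on S, H₀∈S and 𝓕⊆S. For 𝓦⊆S let Post⁺(𝓦)={y | ∃x∈𝓦, (x,y) belongs to the transitive closure of R} and Post*(𝓦)={y | ∃x∈𝓦, (x,y) belongs to the reflexive-transitive closure of R}. Define E₀ = Post*({H₀}) ∩ 𝓕 and, for i≥1, E_i = Post⁺(E_{i−1}) ∩ 𝓕. Then for every i≥1: E_i = E_{i−1} if and only if E_{i−1} is the greatest fixed point, in the complete lattice of subsets of S, of the monotone map X ↦ Post⁺(X) ∩ 𝓕 ∩ Post*({H₀}). -/

import Mathlib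

/-- With `Post⁺`/`Post*` the successor operators of a relation `R`,
`E₀ = Post*({H₀}) ∩ 𝓕` and `E_i = Post⁺(E_{i-1}) ∩ 𝓕`, we have for every `i ≥ 1`:
`E_i = E_{i-1}` iff `E_{i-1}` is the greatest fixed point of
`X ↦ Post⁺(X) ∩ 𝓕 ∩ Post*({H₀})`. -/
theorem gfp_iteration {S : Type*} (R : S → S → Prop) (H0 : S) (F : Set S) :
    let PostPlus : Set S → Set S := fun W => {y | ∃ x ∈ W, Relation.TransGen R x y}
    let PostStar : Set S → Set S := fun W => {y | ∃ x ∈ W, Relation.ReflTransGen R x y}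
    let Phi : Set S → Set S := fun X => PostPlus X ∩ F ∩ PostStar {H0}
    let E : ℕ → Set S :=
      fun i => Nat.rec (PostStar {H0} ∩ F) (fun _ Ei => PostPlus Ei ∩ F) i
    ∀ i : ℕ, 1 ≤ i → (E i = E (i - 1) ↔ IsGreatest {X | Phi X = X} (E (i - 1))) := by
  intro PostPlus PostStar Phi E i hi
  obtain ⟨n, rfl⟩ : ∃ n, i = n + 1 := ⟨i - 1, by omega⟩
  rw [Nat.add_sub_cancel]
  have E_subset_postStar (n : ℕ) : E n ⊆ PostStar {H0} := by
    induction n with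
    | zero => exact Set.inter_subset_left
    | succ n ih =>
      rintro y ⟨⟨x, hx, hxy⟩, -⟩
      obtain ⟨z, hz, hzx⟩ := ih hx
      exact ⟨z, hz, hzx.trans hxy.to_reflTransGen⟩
  have Phi_E (n : ℕ) : Phi (E n) = E (n + 1) :=
    Set.inter_eq_left.mpr (E_subset_postStar (n + 1))
  have fixed_subset_E {X : Set S} (hX : Phi X = X) (n : ℕ) : X ⊆ E n := by
    induction n with
    | zero =>
      intro y hy
      rw [← hX] at hy
      exact ⟨hy.2, hy.1.2⟩
    | succ n ih =>
      intro y hy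
      rw [← hX] at hy
      obtain ⟨⟨⟨x, hx, hxy⟩, hyF⟩, -⟩ := hy
      exact ⟨⟨x, ih hx, hxy⟩, hyF⟩
  constructor
  · intro h
    exact ⟨(Phi_E n).trans h, fun X hX => fixed_subset_E hX n⟩
  · intro h
    exact (Phi_E n).symm.trans h.1
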